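/- Sublinear convergence of three-operator splitting with two Lipschitz operators (Theorem 2): Let d ≥ 1, let g : ℝ^d → ℝ be convex, let f : ℝ^d → ℝ be convex and differentiable with L_f-Lipschitz gradient (L_f > 0), and let h : ℝ^d → ℝ be convex and differentiable with L_h-Lipschitz gradient (L_h > 0). Set F = f + g + h. Suppose θ, α, λ > 0 and σ₁, σ₂, σ₃ ≥ 0 are such that the 4×4 symmetric real matrix W₁ + σ₁Q₁ + σ₂Q₂ + σ₃Q₃ is negative semidefinite, where W₁ has rows [λ² + θ(1/α + L_f/2 − 2/(α²L_h)), θ/(α²L_h), −λ² − θ(1/(2α) + L_f/2), −λ + θ/(α²L_h)], [θ/(α²L_h), −θ/(2α²L_h), 0, −θ/(2α²L_h)], [−λ² − θ(1/(2α) + L_f/2), 0, λ² + θL_f/2, λ], [−λ + θ/(α²L_h), −θ/(2α²L_h), λ, −θ/(2α²L_h)], and Q₁ = B_gᵀ·[[0,1/2],[1/2,0]]·B_g with B_g = [[α,0,0,0],[−1,0,0,1]], Q₂ = B_hᵀ·[[0,1/2],[1/2,−1/L_h]]·B_h with B_h = [[α,0,0,0],[2,−1,0,−1]], Q₃ = B_fᵀ·[[0,1/2],[1/2,−1/L_f]]·B_f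 with B_f = [[0,0,α,0],[0,1,−1,0]]. Then along any TOS trajectory with stepsize α and relaxation λ (with p_f^k = ∇f(x_A^k)) that admits a TOS fixed point (z*, x*, y*, p_g*, ∇f(x*)), one has for every k ≥ 1: min over 0 ≤ i < k of (F(x_B^i) − F(x*)) ≤ ‖z⁰ − z*‖² / (θ k). -/

import Mathlib

open scoped RealInnerProductSpace
open Matrix

/-- The matrix `W₁` appearing in the two-Lipschitz-operator sublinear-rate certificate. -/
noncomputable def W1mat (α lam θ L_f L_h : ℝ) : Matrix (Fin 4) (Fin 4) ℝ :=
  !![lam ^ 2 + θ * (1 / α + L_f / 2 - 2 / (α ^ 2 * L_h)), θ / (α ^ 2 * L_h),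
       -lam ^ 2 - θ * (1 / (2 * α) + L_f / 2), -lam + θ / (α ^ 2 * L_h);
     θ / (α ^ 2 * L_h), -θ / (2 * α ^ 2 * L_h), 0, -θ / (2 * α ^ 2 * L_h);
     -lam ^ 2 - θ * (1 / (2 * α) + L_f / 2), 0, lam ^ 2 + θ * L_f / 2, lam;
     -lam + θ / (α ^ 2 * L_h), -θ / (2 * α ^ 2 * L_h), lam, -θ / (2 * α ^ 2 * L_h)]

noncomputable def BgMat (α : ℝ) : Matrix (Fin 2) (Fin 4) ℝ := !![α, 0, 0, 0; -1, 0, 0, 1]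

noncomputable def BhMat (α : ℝ) : Matrix (Fin 2) (Fin 4) ℝ := !![α, 0, 0, 0; 2, -1, 0, -1]

noncomputable def BfMat (α : ℝ) : Matrix (Fin 2) (Fin 4) ℝ := !![0, 0, α, 0; 0, 1, -1, 0]

/-- `Q₁ = B_gᵀ · [[0,1/2],[1/2,0]] · B_g`. -/
noncomputable def Q1mat (α : ℝ) : Matrix (Fin 4) (Fin 4) ℝ :=
  (BgMat α)ᵀ * !![(0 : ℝ), 1 / 2; 1 / 2, 0] * BgMat α

/-- `Q₂ = B_hᵀ · [[0,1/2],[1/2,−1/L_h]] · B_h`. -/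
noncomputable def Q2mat (α L_h : ℝ) : Matrix (Fin 4) (Fin 4) ℝ :=
  (BhMat α)ᵀ * !![(0 : ℝ), 1 / 2; 1 / 2, -1 / L_h] * BhMat α

/-- `Q₃ = B_fᵀ · [[0,1/2],[1/2,−1/L_f]] · B_f`. -/
noncomputable def Q3mat (α L_f : ℝ) : Matrix (Fin 4) (Fin 4) ℝ :=
  (BfMat α)ᵀ * !![(0 : ℝ), 1 / 2; 1 / 2, -1 / L_f] * BfMat α

section ConvexSmooth

variable {F : Type*} [NormedAddCommGroup F] [InnerProductSpace ℝ F] [CompleteSpace F]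

theorem HasGradientAt.hasDerivAt_add_smul {φ : F → ℝ} {p x v : F} {t : ℝ}
    (hφ : HasGradientAt φ p (x + t • v)) :
    HasDerivAt (fun s : ℝ => φ (x + s • v)) ⟪p, v⟫ t := by
  have hline : HasDerivAt (fun s : ℝ => x + s • v) v t := by
    simpa using ((hasDerivAt_id t).smul_const v).const_add x
  simpa [Function.comp_def] using hφ.hasFDerivAt.comp_hasDerivAt t hline

/-- The first-order lower bound for a convex function. -/
theorem ConvexOn.add_inner_gradient_le {φ : F → ℝ} (hφ : ConvexOn ℝ Set.univ φ) {p x : F}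
    (hp : HasGradientAt φ p x) (w : F) : φ x + ⟪p, w - x⟫ ≤ φ w := by
  have hconv : ConvexOn ℝ Set.univ (fun s : ℝ => φ (x + s • (w - x))) := by
    have := hφ.comp_affineMap (AffineMap.lineMap x w : ℝ →ᵃ[ℝ] F)
    simpa [Function.comp_def, AffineMap.lineMap_apply, add_comm] using this
  have hderiv : HasDerivAt (fun s : ℝ => φ (x + s • (w - x))) ⟪p, w - x⟫ 0 :=
    HasGradientAt.hasDerivAt_add_smul (by simpa using hp)
  have := hconv.le_slope_of_hasDerivAt (Set.mem_univ 0) (Set.mem_univ 1) one_pos hderiv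
  simp [slope_def_field] at this
  linarith

/-- The descent lemma for a function with Lipschitz gradient. -/
theorem le_add_inner_add_of_lipschitz_gradient {φ : F → ℝ} {φ' : F → F} {L : ℝ}
    (hφ : ∀ x, HasGradientAt φ (φ' x) x) (hL : ∀ x y, ‖φ' x - φ' y‖ ≤ L * ‖x - y‖) (x w : F) :
    φ w ≤ φ x + ⟪φ' x, w - x⟫ + L / 2 * ‖w - x‖ ^ 2 := by
  have hf (t : ℝ) : HasDerivAt (fun s : ℝ => φ (x + s • (w - x)))
      ⟪φ' (x + t • (w - x)), w - x⟫ t := (hφ _).hasDerivAt_add_smul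
  have hB (t : ℝ) : HasDerivAt
      (fun s : ℝ => φ x + s * ⟪φ' x, w - x⟫ + L / 2 * ‖w - x‖ ^ 2 * s ^ 2)
      (⟪φ' x, w - x⟫ + L * ‖w - x‖ ^ 2 * t) t := by
    have h1 := ((hasDerivAt_id t).mul_const ⟪φ' x, w - x⟫).const_add (φ x)
    have h2 := (hasDerivAt_pow 2 t).const_mul (L / 2 * ‖w - x‖ ^ 2)
    refine (h1.add h2).congr_deriv ?_
    simp
    ring
  have hle := image_le_of_deriv_right_le_deriv_boundary (a := 0) (b := 1)
    (fun t _ => (hf t).continuousAt.continuousWithinAt) (fun t _ => (hf t).hasDerivWithinAt)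
    (by simp) (fun t _ => (hB t).continuousAt.continuousWithinAt)
    (fun t _ => (hB t).hasDerivWithinAt) (fun t ht => ?_) (Set.right_mem_Icc.2 zero_le_one)
  · simpa using hle
  · have hbound : ⟪φ' (x + t • (w - x)) - φ' x, w - x⟫ ≤ L * ‖t • (w - x)‖ * ‖w - x‖ := by
      refine (real_inner_le_norm _ _).trans ?_
      gcongr
      simpa using hL (x + t • (w - x)) x
    rw [inner_sub_left, norm_smul, Real.norm_of_nonneg ht.1] at hbound
    linarith

/-- The interpolation inequality for a convex function with Lipschitz gradient. -/
theorem ConvexOn.add_inner_add_norm_sq_le {φ : F → ℝ} {φ' : F → F} {L : ℝ}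
    (hconv : ConvexOn ℝ Set.univ φ) (hLpos : 0 < L)
    (hφ : ∀ x, HasGradientAt φ (φ' x) x) (hL : ∀ x y, ‖φ' x - φ' y‖ ≤ L * ‖x - y‖) (x w : F) :
    φ x + ⟪φ' x, w - x⟫ + 1 / (2 * L) * ‖φ' w - φ' x‖ ^ 2 ≤ φ w := by
  set q := φ' w - φ' x with hq
  have hlow := hconv.add_inner_gradient_le (hφ x) (w - (1 / L) • q)
  have hup := le_add_inner_add_of_lipschitz_gradient hφ hL w (w - (1 / L) • q)
  have hqq : ⟪φ' w, q⟫ - ⟪φ' x, q⟫ = ‖q‖ ^ 2 := by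
    rw [← inner_sub_left, ← hq, real_inner_self_eq_norm_sq]
  rw [sub_right_comm, inner_sub_right, inner_smul_right] at hlow
  rw [sub_sub_cancel_left, inner_neg_right, inner_smul_right, norm_neg, norm_smul,
    Real.norm_of_nonneg (by positivity)] at hup
  have hcoef : 1 / L * ‖q‖ ^ 2 - L / 2 * (1 / L * ‖q‖) ^ 2 = 1 / (2 * L) * ‖q‖ ^ 2 := by
    field_simp
    ring
  linear_combination hlow + hup - hcoef - 1 / L * hqq

/-- Cocoercivity of the Lipschitz gradient of a convex function (Baillon–Haddad). -/
theorem ConvexOn.norm_sq_le_inner_gradient {φ : F → ℝ} {φ' : F → F} {L : ℝ}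
    (hconv : ConvexOn ℝ Set.univ φ) (hLpos : 0 < L)
    (hφ : ∀ x, HasGradientAt φ (φ' x) x) (hL : ∀ x y, ‖φ' x - φ' y‖ ≤ L * ‖x - y‖) (x w : F) :
    1 / L * ‖φ' x - φ' w‖ ^ 2 ≤ ⟪x - w, φ' x - φ' w⟫ := by
  have h1 := hconv.add_inner_add_norm_sq_le hLpos hφ hL x w
  have h2 := hconv.add_inner_add_norm_sq_le hLpos hφ hL w x
  have hcoef : 1 / L = 2 * (1 / (2 * L)) := by field_simp
  rw [norm_sub_rev] at h1
  rw [← neg_sub x w, inner_neg_right] at h1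
  rw [real_inner_comm, inner_sub_left, hcoef]
  linarith

end ConvexSmooth

/-- A negative semidefinite matrix stays so when its quadratic form is evaluated on vectors. -/
theorem sum_mul_inner_nonpos {ι κ : Type*} [Fintype ι] [Fintype κ] {M : Matrix κ κ ℝ}
    (hM : ∀ v : κ → ℝ, v ⬝ᵥ (M *ᵥ v) ≤ 0) (u : κ → EuclideanSpace ℝ ι) :
    ∑ i, ∑ j, M i j * ⟪u i, u j⟫ ≤ 0 := by
  have hsum : ∑ i, ∑ j, M i j * ⟪u i, u j⟫ =
      ∑ l, (fun i => u i l) ⬝ᵥ (M *ᵥ fun i => u i l) := by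
    simp only [PiLp.inner_apply, dotProduct, mulVec, Finset.mul_sum]
    rw [Finset.sum_comm_cycle]
    refine Finset.sum_congr rfl fun l _ => Finset.sum_congr rfl fun i _ =>
      Finset.sum_congr rfl fun j _ => ?_
    simp only [RCLike.inner_apply, conj_trivial]
    ring
  rw [hsum]
  exact Finset.sum_nonpos fun l _ => hM _

/-- The quadratic form of the certificate, evaluated on the deviations of one iteration from a
fixed point: `a`, `P`, `H`, `G` are the deviations of `x_B`, `p_g`, `∇h(x_B)`, `∇f(x_A)`. -/
theorem tos_certificate_eq {F : Type*} [NormedAddCommGroup F] [InnerProductSpace ℝ F]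
    {α lam θ L_f L_h σ₁ σ₂ σ₃ : ℝ} (hα : α ≠ 0) (hLf : L_f ≠ 0) (hLh : L_h ≠ 0)
    {a b c e P H G : F} (he : e = a + α • P) (hb : b = a - α • P - α • H) (hc : c = b - α • G) :
    ∑ i, ∑ j, (W1mat α lam θ L_f L_h + σ₁ • Q1mat α + σ₂ • Q2mat α L_h + σ₃ • Q3mat α L_f) i j *
        ⟪(![a, b, c, e] : Fin 4 → F) i, (![a, b, c, e] : Fin 4 → F) j⟫ =
      ‖e + lam • (c - a)‖ ^ 2 - ‖e‖ ^ 2 +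
        θ * (⟪P + H + G, a⟫ + L_f / 2 * ‖a - c‖ ^ 2 - 1 / (2 * L_h) * ‖H‖ ^ 2) +
        σ₁ * (α ^ 2 * ⟪a, P⟫) +
        σ₂ * (α ^ 2 * (⟪a, H⟫ - 1 / L_h * ‖H‖ ^ 2)) +
        σ₃ * (α ^ 2 * (⟪c, G⟫ - 1 / L_f * ‖G‖ ^ 2)) := by
  subst hc hb he
  simp only [← real_inner_self_eq_norm_sq, W1mat, Q1mat, Q2mat, Q3mat, BgMat, BhMat, BfMat,
    Fin.sum_univ_four, Matrix.add_apply, Matrix.smul_apply, Matrix.mul_apply, Fin.sum_univ_two,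
    Matrix.transpose_apply, Matrix.of_apply, Matrix.cons_val, smul_eq_mul,
    inner_add_left, inner_add_right, inner_sub_left, inner_sub_right,
    inner_smul_left, inner_smul_right, conj_trivial]
  rw [real_inner_comm a P, real_inner_comm a H, real_inner_comm a G, real_inner_comm P H,
    real_inner_comm P G, real_inner_comm H G]
  field_simp
  ring

/-- **Theorem 2** (sublinear convergence of three-operator splitting with two Lipschitz
operators). If `W₁ + σ₁Q₁ + σ₂Q₂ + σ₃Q₃ ⪯ 0`, then along any TOS trajectory admitting a
fixed point, the smallest objective-value suboptimality among the first `k` iterates is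
bounded by `‖z⁰ − z*‖² / (θ k)`. -/
theorem tos_sublinear_two_lipschitz
    {d : ℕ} (hd : 1 ≤ d)
    (f g h : EuclideanSpace ℝ (Fin d) → ℝ)
    (fgrad hgrad : EuclideanSpace ℝ (Fin d) → EuclideanSpace ℝ (Fin d))
    (L_f L_h : ℝ) (hLf : 0 < L_f) (hLh : 0 < L_h)
    (hf : ConvexOn ℝ Set.univ f) (hg : ConvexOn ℝ Set.univ g)
    (hh : ConvexOn ℝ Set.univ h)
    (hfdiff : ∀ x, HasGradientAt f (fgrad x) x)
    (hhdiff : ∀ x, HasGradientAt h (hgrad x) x)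
    (hflip : ∀ x y, ‖fgrad x - fgrad y‖ ≤ L_f * ‖x - y‖)
    (hhlip : ∀ x y, ‖hgrad x - hgrad y‖ ≤ L_h * ‖x - y‖)
    (θ α lam σ₁ σ₂ σ₃ : ℝ)
    (hθ : 0 < θ) (hα : 0 < α) (hlam : 0 < lam)
    (hσ₁ : 0 ≤ σ₁) (hσ₂ : 0 ≤ σ₂) (hσ₃ : 0 ≤ σ₃)
    (hNSD : ∀ v : Fin 4 → ℝ,
      v ⬝ᵥ ((W1mat α lam θ L_f L_h + σ₁ • Q1mat α + σ₂ • Q2mat α L_h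
        + σ₃ • Q3mat α L_f) *ᵥ v) ≤ 0)
    -- TOS trajectory (with `p_f^k = ∇f(x_A^k)`)
    (z xB y xA pg : ℕ → EuclideanSpace ℝ (Fin d))
    (hsubg : ∀ k w, g (xB k) + ⟪pg k, w - xB k⟫ ≤ g w)
    (hxB : ∀ k, xB k = z k - α • pg k)
    (hy : ∀ k, y k = (2 : ℝ) • xB k - z k - α • hgrad (xB k))
    (hxA : ∀ k, xA k = y k - α • fgrad (xA k))
    (hz : ∀ k, z (k + 1) = z k + lam • (xA k - xB k))
    -- TOS fixed point
    (zs xs ys pgs : EuclideanSpace ℝ (Fin d))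
    (hsubgs : ∀ w, g xs + ⟪pgs, w - xs⟫ ≤ g w)
    (hxs : xs = zs - α • pgs)
    (hys : ys = (2 : ℝ) • xs - zs - α • hgrad xs)
    (hxAs : xs = ys - α • fgrad xs)
    (k : ℕ) (hk : 1 ≤ k) :
    ∃ i < k, (f (xB i) + g (xB i) + h (xB i)) - (f xs + g xs + h xs) ≤
      ‖z 0 - zs‖ ^ 2 / (θ * k) := by
  have hstep (i : ℕ) : θ * ((f (xB i) + g (xB i) + h (xB i)) - (f xs + g xs + h xs)) ≤
      ‖z i - zs‖ ^ 2 - ‖z (i + 1) - zs‖ ^ 2 := by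
    have he : z i - zs = (xB i - xs) + α • (pg i - pgs) := by
      rw [hxB i, hxs]; module
    have hb : y i - ys = (xB i - xs) - α • (pg i - pgs) - α • (hgrad (xB i) - hgrad xs) := by
      linear_combination (norm := module) hy i - hys - hxs + hxB i
    have hc : xA i - xs = (y i - ys) - α • (fgrad (xA i) - fgrad xs) := by
      linear_combination (norm := module) hxA i - hxAs
    have hzs : z (i + 1) - zs = (z i - zs) + lam • ((xA i - xs) - (xB i - xs)) := by
      rw [hz i]; module
    have hopt : pgs + hgrad xs + fgrad xs = 0 := by
      refine (smul_eq_zero.1 (?_ : α • (pgs + hgrad xs + fgrad xs) = 0)).resolve_left hα.ne'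
      linear_combination (norm := module) hxs + hys + hxAs
    have hM := sum_mul_inner_nonpos hNSD ![xB i - xs, y i - ys, xA i - xs, z i - zs]
    rw [tos_certificate_eq hα.ne' hLf.ne' hLh.ne' he hb hc, ← hzs, sub_sub_sub_cancel_right] at hM
    have hQ₁ : 0 ≤ ⟪xB i - xs, pg i - pgs⟫ := by
      have h1 := hsubg i xs
      have h2 := hsubgs (xB i)
      rw [← neg_sub, inner_neg_right] at h1
      rw [real_inner_comm, inner_sub_left]
      linarith
    have hQ₂ := sub_nonneg.2 (hh.norm_sq_le_inner_gradient hLh hhdiff hhlip (xB i) xs)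
    have hQ₃ := sub_nonneg.2 (hf.norm_sq_le_inner_gradient hLf hfdiff hflip (xA i) xs)
    have hf₁ := le_add_inner_add_of_lipschitz_gradient hfdiff hflip (xA i) (xB i)
    have hf₂ := hf.add_inner_gradient_le (hfdiff (xA i)) xs
    have hg₁ := hsubg i xs
    have hh₁ := hh.add_inner_add_norm_sq_le hLh hhdiff hhlip (xB i) xs
    rw [norm_sub_rev (hgrad xs)] at hh₁
    have hsum : (pg i - pgs) + (hgrad (xB i) - hgrad xs) + (fgrad (xA i) - fgrad xs) =
        pg i + hgrad (xB i) + fgrad (xA i) := by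
      linear_combination (norm := module) -hopt
    rw [hsum] at hM
    have hgap : (f (xB i) + g (xB i) + h (xB i)) - (f xs + g xs + h xs) ≤
        ⟪pg i + hgrad (xB i) + fgrad (xA i), xB i - xs⟫ + L_f / 2 * ‖xB i - xA i‖ ^ 2 -
          1 / (2 * L_h) * ‖hgrad (xB i) - hgrad xs‖ ^ 2 := by
      simp only [inner_add_left, inner_sub_right] at hf₁ hf₂ hg₁ hh₁ ⊢
      linarith
    have hgapθ := mul_le_mul_of_nonneg_left hgap hθ.le
    have hα2 := sq_nonneg α
    have t₁ := mul_nonneg hσ₁ (mul_nonneg hα2 hQ₁)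
    have t₂ := mul_nonneg hσ₂ (mul_nonneg hα2 hQ₂)
    have t₃ := mul_nonneg hσ₃ (mul_nonneg hα2 hQ₃)
    linarith
  have hkpos : (0 : ℝ) < k := by exact_mod_cast hk
  by_contra! hcon
  have htel := Finset.sum_range_sub' (fun i => ‖z i - zs‖ ^ 2) k
  have hlt : ∑ _i ∈ Finset.range k, ‖z 0 - zs‖ ^ 2 / k <
      ∑ i ∈ Finset.range k, (‖z i - zs‖ ^ 2 - ‖z (i + 1) - zs‖ ^ 2) := by
    refine Finset.sum_lt_sum_of_nonempty (Finset.nonempty_range_iff.2 (by lia)) fun i hi => ?_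
    refine lt_of_lt_of_le ?_ (hstep i)
    have := mul_lt_mul_of_pos_left (hcon i (Finset.mem_range.1 hi)) hθ
    rwa [← mul_div_assoc, mul_div_mul_left _ _ hθ.ne'] at this
  rw [htel, Finset.sum_const, Finset.card_range, nsmul_eq_mul, mul_div_cancel₀ _ hkpos.ne'] at hlt
  linarith [sq_nonneg ‖z k - zs‖]
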